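/- Let J' be the tree obtained from a path y_0 y_1 … y_7 on 8 vertices by attaching a pendant path of two vertices to y_4. Then: (a) there is no (2,2,3,3)-packing coloring c of J' with c(y_0) = c(y_7) ∈ {3, 4}, i.e., y_0 and y_7 never receive the same color from the two 3-packing classes; and (b) there exists a (2,2,3,3)-packing coloring of J' with c(y_0) = 3 and c(y_7) = 4. -/

import Mathlib

/-- `c` is an `s`-packing coloring of the simple graph `G`: for each color `i`, any two
distinct vertices with color `i` are at graph distance strictly greater than `s i`
(vertices in different connected components trivially satisfy this). -/
def IsPackingColoring {V : Type*} (G : SimpleGraph V) {k : ℕ} (s : Fin k → ℕ)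
    (c : V → Fin k) : Prop :=
  ∀ u v : V, u ≠ v → c u = c v → G.Reachable u v → s (c u) < G.dist u v

/-- The tree `J'`: a path `y₀ y₁ … y₇` (vertices `0,…,7`) with a pendant path of two
vertices (`8-9`) attached to `y₄`. -/
def treeJ' : SimpleGraph (Fin 10) :=
  SimpleGraph.fromRel (fun u v =>
    (u, v) ∈ ([(0,1),(1,2),(2,3),(3,4),(4,5),(5,6),(6,7),
               (4,8),(8,9)] : List (Fin 10 × Fin 10)))

instance : DecidableRel treeJ'.Adj := fun u v =>
  decidable_of_iff _ (SimpleGraph.fromRel_adj _ u v).symm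

theorem IsPackingColoring.ne_of_walk {V : Type*} {G : SimpleGraph V} {k : ℕ} {s : Fin k → ℕ}
    {c : V → Fin k} (hc : IsPackingColoring G s c) {u v : V} (w : G.Walk u v) (huv : u ≠ v)
    (hw : w.length ≤ s (c u)) : c u ≠ c v := fun h =>
  (hc u v huv h w.reachable).not_ge ((G.dist_le w).trans hw)

/-- A function that vanishes at `u` and grows by at most one along each edge is a lower bound
for the distance from `u`. -/
theorem SimpleGraph.Reachable.le_dist_of_adj_le_succ {V : Type*} {G : SimpleGraph V} {u v : V}
    (huv : G.Reachable u v) (f : V → ℕ) (hu : f u = 0)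
    (hf : ∀ a b, G.Adj a b → f b ≤ f a + 1) : f v ≤ G.dist u v := by
  obtain ⟨w, hw⟩ := huv.exists_walk_length_eq_dist
  have key : ∀ {a b : V} (w : G.Walk a b), f b ≤ f a + w.length := by
    intro a b w
    induction w with
    | nil => simp
    | cons h _ ih =>
      have := hf _ _ h
      rw [SimpleGraph.Walk.length_cons]
      omega
  have := key w
  omega

/-- Six consecutive vertices of a path cannot be `(2,2,3,3)`-packing colored when one
of the four colors, here `a`, is excluded. -/
theorem six_colors_contradiction {a x₁ x₂ x₃ x₄ x₅ x₆ : Fin 4}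
    (h₁ : x₁ ≠ a) (h₂ : x₂ ≠ a) (h₃ : x₃ ≠ a) (h₄ : x₄ ≠ a) (h₅ : x₅ ≠ a) (h₆ : x₆ ≠ a)
    (h₁₂ : x₁ ≠ x₂) (h₁₃ : x₁ ≠ x₃) (h₂₃ : x₂ ≠ x₃) (h₂₄ : x₂ ≠ x₄) (h₃₄ : x₃ ≠ x₄)
    (h₃₅ : x₃ ≠ x₅) (h₄₅ : x₄ ≠ x₅) (h₄₆ : x₄ ≠ x₆) (h₅₆ : x₅ ≠ x₆)
    (h₁₄ : 2 ≤ x₁ → x₁ ≠ x₄) (h₂₅ : 2 ≤ x₂ → x₂ ≠ x₅) (h₃₆ : 2 ≤ x₃ → x₃ ≠ x₆) : False := by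
  omega

/-- The distance function of `treeJ'`: vertices `8` and `9` hang at depths `1` and `2`
below vertex `4`. -/
def treeJ'Dist (u v : Fin 10) : ℕ :=
  let foot (x : Fin 10) : ℕ := if x < 8 then x else 4
  let depth (x : Fin 10) : ℕ := x - 7
  if foot u = foot v then Nat.dist (depth u) (depth v)
  else Nat.dist (foot u) (foot v) + depth u + depth v

theorem treeJ'Dist_le_dist {u v : Fin 10} (huv : treeJ'.Reachable u v) :
    treeJ'Dist u v ≤ treeJ'.dist u v :=
  huv.le_dist_of_adj_le_succ (treeJ'Dist u) (by clear huv; revert u; decide)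
    (by clear huv; revert u; decide)

/-- In a `(2,2,3,3)`-packing coloring (colors `2` and `3` are the two `3`-packing
classes): (a) `y₀` and `y₇` never receive the same color from `{2, 3}`;
(b) there is a coloring with `c y₀ = 2` and `c y₇ = 3`. -/
theorem treeJ'_antitransmitter :
    (¬ ∃ c : Fin 10 → Fin 4, IsPackingColoring treeJ' ![2, 2, 3, 3] c ∧
        c 0 = c 7 ∧ (c 0 = 2 ∨ c 0 = 3)) ∧
    (∃ c : Fin 10 → Fin 4, IsPackingColoring treeJ' ![2, 2, 3, 3] c ∧
        c 0 = 2 ∧ c 7 = 3) := by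
  have hadj : ∀ i : Fin 7, treeJ'.Adj (i.castLE (by decide)) (i.succ.castLE (by decide)) := by
    decide
  constructor
  · rintro ⟨c, hc, h07, h0⟩
    have two_le (x : Fin 4) : 2 ≤ (![2, 2, 3, 3] : Fin 4 → ℕ) x := by revert x; decide
    have three_le (x : Fin 4) : 2 ≤ x → 3 ≤ (![2, 2, 3, 3] : Fin 4 → ℕ) x := by
      revert x; decide
    have near₁ {u v : Fin 10} (h : treeJ'.Adj u v) : c u ≠ c v :=
      hc.ne_of_walk h.toWalk h.ne ((by simp : _ ≤ 2).trans (two_le _))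
    have near₂ {u v w : Fin 10} (h : treeJ'.Adj u v) (h' : treeJ'.Adj v w) (hne : u ≠ w) :
        c u ≠ c w :=
      hc.ne_of_walk (.cons h h'.toWalk) hne (two_le _)
    have near₃ {u v w x : Fin 10} (h : treeJ'.Adj u v) (h' : treeJ'.Adj v w)
        (h'' : treeJ'.Adj w x) (hne : u ≠ x) (hu : 2 ≤ c u) : c u ≠ c x :=
      hc.ne_of_walk (.cons h (.cons h' h''.toWalk)) hne (three_le _ hu)
    have a₀ : treeJ'.Adj 0 1 := hadj 0
    have a₁ : treeJ'.Adj 1 2 := hadj 1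
    have a₂ : treeJ'.Adj 2 3 := hadj 2
    have a₃ : treeJ'.Adj 3 4 := hadj 3
    have a₄ : treeJ'.Adj 4 5 := hadj 4
    have a₅ : treeJ'.Adj 5 6 := hadj 5
    have a₆ : treeJ'.Adj 6 7 := hadj 6
    have h0' : 2 ≤ c 0 := by omega
    exact six_colors_contradiction
      (near₁ a₀).symm (near₂ a₀ a₁ (by decide)).symm (near₃ a₀ a₁ a₂ (by decide) h0').symm
      (h07 ▸ (near₃ a₆.symm a₅.symm a₄.symm (by decide) (h07 ▸ h0')).symm)
      (h07 ▸ near₂ a₅ a₆ (by decide)) (h07 ▸ near₁ a₆)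
      (near₁ a₁) (near₂ a₁ a₂ (by decide)) (near₁ a₂) (near₂ a₂ a₃ (by decide)) (near₁ a₃)
      (near₂ a₃ a₄ (by decide)) (near₁ a₄) (near₂ a₄ a₅ (by decide)) (near₁ a₅)
      (near₃ a₁ a₂ a₃ (by decide)) (near₃ a₂ a₃ a₄ (by decide)) (near₃ a₃ a₄ a₅ (by decide))
  · refine ⟨![2, 0, 1, 3, 2, 0, 1, 3, 1, 0], fun u v huv hcol hr =>
      lt_of_lt_of_le ?_ (treeJ'Dist_le_dist hr), rfl, rfl⟩
    clear hr
    revert u v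
    decide
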